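/- Let P ⊂ ℝⁿ be a bounded open convex polytope. Let u be a convex function on P with Alexandrov Hessian H, and let (u_n) be convex functions of class C² on P converging locally uniformly on P to u, such that det(D²u_n(x)) → det(H(x)) for almost every x ∈ P, and such that for some ε₀ > 0 one has det(D²u_n(x)) ≥ ε₀ for all n and almost every x, and det(H(x)) ≥ ε₀ for almost every x. Then for every open set Ω whose closure is compact and contained in P, ∫_Ω log(det H(x)) dx = lim_{n→∞} ∫_Ω log(det D²u_n(x)) dx. -/

import Mathlib

open MeasureTheory Filter Set Metric
open scoped ENNReal RealInnerProductSpace Topology NNReal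

noncomputable section

namespace ToricExtremal

/-- The open polytope `{x | ⟨l i, x⟩ < λ i for all i}` determined by a half-space
presentation with normals `l` and constants `lam`. -/
def Poly {n : ℕ} {ι : Type*} [Fintype ι] (l : ι → EuclideanSpace ℝ (Fin n))
    (lam : ι → ℝ) : Set (EuclideanSpace ℝ (Fin n)) :=
  {x | ∀ i, ⟪l i, x⟫ < lam i}

/-- The inner polytope `P_δ`, whose facets are parallel to those of `P` at distance `δ`. -/
def PolyInner {n : ℕ} {ι : Type*} [Fintype ι] (l : ι → EuclideanSpace ℝ (Fin n))
    (lam : ι → ℝ) (δ : ℝ) : Set (EuclideanSpace ℝ (Fin n)) :=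
  {x | ∀ i, ⟪l i, x⟫ < lam i - ‖l i‖ * δ}

/-- The facet `F i = {x ∈ ∂P | ⟨l i, x⟩ = λ i}`. -/
def Facet {n : ℕ} {ι : Type*} [Fintype ι] (l : ι → EuclideanSpace ℝ (Fin n))
    (lam : ι → ℝ) (i : ι) : Set (EuclideanSpace ℝ (Fin n)) :=
  {x ∈ frontier (Poly l lam) | ⟪l i, x⟫ = lam i}

/-- `σ₀`: the `(n-1)`-dimensional Hausdorff measure on `ℝⁿ`. -/
def sigma0 (n : ℕ) : Measure (EuclideanSpace ℝ (Fin n)) := μH[(n : ℝ) - 1]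

/-- The weighted boundary measure `σ`, equal to `|l i|⁻¹ σ₀` on the facet `F i`. -/
def sigmaW {n : ℕ} {ι : Type*} [Fintype ι] (l : ι → EuclideanSpace ℝ (Fin n))
    (lam : ι → ℝ) : Measure (EuclideanSpace ℝ (Fin n)) :=
  ∑ i : ι, (ENNReal.ofReal (1 / ‖l i‖)) • ((sigma0 n).restrict (Facet l lam i))

/-- The Delzant condition: every normal `l i` is a primitive integral vector, and every
vertex (extreme point of the closure) lies on exactly `n` facets whose normals form a
`ℤ`-basis of `ℤⁿ` (equivalently, an integral matrix of determinant `±1`). -/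
def IsDelzant {n : ℕ} {ι : Type*} [Fintype ι] (l : ι → EuclideanSpace ℝ (Fin n))
    (lam : ι → ℝ) : Prop :=
  (∀ i j, ∃ m : ℤ, l i j = (m : ℝ)) ∧
  (∀ i, ∀ k : ℕ, 2 ≤ k → ¬ (∀ j, ∃ m : ℤ, l i j = (k : ℝ) * (m : ℝ))) ∧
  (∀ x ∈ Set.extremePoints ℝ (closure (Poly l lam)),
    ∃ e : Fin n ≃ {i : ι // ⟪l i, x⟫ = lam i},
      |(Matrix.of fun j k => l (e j).1 k).det| = 1)

/-- The second partial derivative `∂²u/∂xᵢ∂xⱼ` at `x`. -/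
def secondPartial {n : ℕ} (u : EuclideanSpace ℝ (Fin n) → ℝ) (i j : Fin n)
    (x : EuclideanSpace ℝ (Fin n)) : ℝ :=
  iteratedFDeriv ℝ 2 u x ![EuclideanSpace.single i 1, EuclideanSpace.single j 1]

/-- The (classical) Hessian matrix `D²u(x)`. -/
def hessianMatrix {n : ℕ} (u : EuclideanSpace ℝ (Fin n) → ℝ)
    (x : EuclideanSpace ℝ (Fin n)) : Matrix (Fin n) (Fin n) ℝ :=
  Matrix.of fun i j => secondPartial u i j x

/-- Guillemin's canonical potential `u_P(x) = Σᵢ (λᵢ − ⟨lᵢ,x⟩) log (λᵢ − ⟨lᵢ,x⟩)`. -/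
def guillemin {n : ℕ} {ι : Type*} [Fintype ι] (l : ι → EuclideanSpace ℝ (Fin n))
    (lam : ι → ℝ) (x : EuclideanSpace ℝ (Fin n)) : ℝ :=
  ∑ i : ι, (lam i - ⟪l i, x⟫) * Real.log (lam i - ⟪l i, x⟫)

/-- `(u_P)^{ij}_{ij}`: the double divergence `Σ_{i,j} ∂²((D²u_P)⁻¹)_{ij}/∂xᵢ∂xⱼ` of the
inverse Hessian of the Guillemin potential. -/
def divDivInvHessGuillemin {n : ℕ} {ι : Type*} [Fintype ι]
    (l : ι → EuclideanSpace ℝ (Fin n)) (lam : ι → ℝ) (x : EuclideanSpace ℝ (Fin n)) : ℝ :=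
  ∑ i : Fin n, ∑ j : Fin n,
    secondPartial (fun y => (hessianMatrix (guillemin l lam) y)⁻¹ i j) i j x

/-- `H` is an Alexandrov Hessian of `u` on `P`: a measurable matrix-valued map which is
a.e. positive semidefinite and gives the second-order Taylor expansion of `u` at a.e.
point of `P`. -/
def IsAlexHessian {n : ℕ} (P : Set (EuclideanSpace ℝ (Fin n)))
    (u : EuclideanSpace ℝ (Fin n) → ℝ)
    (H : EuclideanSpace ℝ (Fin n) → Matrix (Fin n) (Fin n) ℝ) : Prop :=
  (∀ i j, Measurable fun x => H x i j) ∧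
  ∀ᵐ x ∂(volume.restrict P),
    (H x).PosSemidef ∧
    ∃ g : EuclideanSpace ℝ (Fin n),
      Tendsto (fun y : EuclideanSpace ℝ (Fin n) =>
          (u y - u x - ⟪g, y - x⟫
            - (1 / 2) * ∑ i : Fin n, ∑ j : Fin n, H x i j * (y - x) i * (y - x) j)
          / ‖y - x‖ ^ 2)
        (𝓝[≠] x) (𝓝 0)

/-- The radial boundary extension `u(z) = lim_{t→1⁻} u (t • z)` (as a value in `[0,∞]`,
computed via `limsup` so as to be everywhere defined). -/
def radExt {n : ℕ} (u : EuclideanSpace ℝ (Fin n) → ℝ) (z : EuclideanSpace ℝ (Fin n)) : ℝ≥0∞ :=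
  Filter.limsup (fun t : ℝ => ENNReal.ofReal (u (t • z))) (𝓝[<] (1 : ℝ))

/-- The radial limits of `u` exist (in `[0,∞]`) at every boundary point of `P`. -/
def HasRadExt {n : ℕ} (P : Set (EuclideanSpace ℝ (Fin n)))
    (u : EuclideanSpace ℝ (Fin n) → ℝ) : Prop :=
  ∀ z ∈ frontier P,
    Tendsto (fun t : ℝ => ENNReal.ofReal (u (t • z))) (𝓝[<] (1 : ℝ)) (𝓝 (radExt u z))

/-- The class `𝒞⋆^K(P)`: nonnegative convex functions on `P`, vanishing at the origin,
whose radial boundary extension has `σ₀`-integral at most `K`. -/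
def MemCstar {n : ℕ} {ι : Type*} [Fintype ι] (l : ι → EuclideanSpace ℝ (Fin n))
    (lam : ι → ℝ) (K : ℝ) (u : EuclideanSpace ℝ (Fin n) → ℝ) : Prop :=
  ConvexOn ℝ (Poly l lam) u ∧ u 0 = 0 ∧ (∀ x ∈ Poly l lam, 0 ≤ u x) ∧
  HasRadExt (Poly l lam) u ∧
  ∫⁻ z in frontier (Poly l lam), radExt u z ∂(sigma0 n) ≤ ENNReal.ofReal K

/-- The class `𝒞`: convex functions of the form `u = u_P + v` with `v` smooth up to the
boundary of `P`. -/
def MemC {n : ℕ} {ι : Type*} [Fintype ι] (l : ι → EuclideanSpace ℝ (Fin n))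
    (lam : ι → ℝ) (u : EuclideanSpace ℝ (Fin n) → ℝ) : Prop :=
  ConvexOn ℝ (Poly l lam) u ∧
  ∃ v : EuclideanSpace ℝ (Fin n) → ℝ, ContDiffOn ℝ (⊤ : ℕ∞) v (closure (Poly l lam)) ∧
    ∀ x ∈ closure (Poly l lam), u x = guillemin l lam x + v x

/-- The normalized class `𝒞̃ = {u ∈ 𝒞 : inf_P u = u 0 = 0}`. -/
def MemCt {n : ℕ} {ι : Type*} [Fintype ι] (l : ι → EuclideanSpace ℝ (Fin n))
    (lam : ι → ℝ) (u : EuclideanSpace ℝ (Fin n) → ℝ) : Prop :=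
  MemC l lam u ∧ u 0 = 0 ∧ ∀ x ∈ Poly l lam, 0 ≤ u x

/-- `f` is an affine function on `ℝⁿ`. -/
def IsAffineFn {n : ℕ} (f : EuclideanSpace ℝ (Fin n) → ℝ) : Prop :=
  ∃ (g : EuclideanSpace ℝ (Fin n)) (c : ℝ), ∀ x, f x = ⟪g, x⟫ + c

/-- The (signed) integral `∫_S log (det H) dx`, with values in `EReal`: it is defined as
the difference of the integrals of the positive part `log⁺` and the negative part `log⁻`. -/
def logDetE {n : ℕ} (S : Set (EuclideanSpace ℝ (Fin n)))
    (H : EuclideanSpace ℝ (Fin n) → Matrix (Fin n) (Fin n) ℝ) : EReal :=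
  ((∫⁻ x in S, ENNReal.ofReal (Real.log (H x).det) : ℝ≥0∞) : EReal)
    - ((∫⁻ x in S, ENNReal.ofReal (-Real.log (H x).det) : ℝ≥0∞) : EReal)

/-- The Donaldson functional
`ℱ(u) = −∫_P log (det H) dx + ∫_{∂P} u dσ − ∫_P f ⬝ u dx`, valued in `EReal`, where `H` is
an Alexandrov Hessian of `u` and the boundary term uses the radial extension of `u`. -/
def Fcal {n : ℕ} {ι : Type*} [Fintype ι] (l : ι → EuclideanSpace ℝ (Fin n)) (lam : ι → ℝ)
    (f : EuclideanSpace ℝ (Fin n) → ℝ) (u : EuclideanSpace ℝ (Fin n) → ℝ)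
    (H : EuclideanSpace ℝ (Fin n) → Matrix (Fin n) (Fin n) ℝ) : EReal :=
  ((∫⁻ z, radExt u z ∂(sigmaW l lam) : ℝ≥0∞) : EReal)
    - ((∫ x in Poly l lam, f x * u x : ℝ) : EReal)
    - logDetE (Poly l lam) H

/-- The half-space presentation of the open rectangle `∏ (αᵢ, βᵢ)`: normals. -/
def rectL (n : ℕ) : (Fin n ⊕ Fin n) → EuclideanSpace ℝ (Fin n) :=
  Sum.elim (fun i => EuclideanSpace.single i 1) (fun i => -EuclideanSpace.single i 1)

/-- The half-space presentation of the open rectangle `∏ (αᵢ, βᵢ)`: constants. -/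
def rectLam {n : ℕ} (α β : Fin n → ℝ) : (Fin n ⊕ Fin n) → ℝ :=
  Sum.elim β (fun i => -α i)


/-- The functional `ℱ` on smooth elements of `𝒞̃` (real-valued):
`ℱ(u) = −∫_P log det D²u + ∫_{∂P} u dσ − ∫_P f ⬝ u dx`. -/
def FcalSmooth {n : ℕ} {ι : Type*} [Fintype ι] (l : ι → EuclideanSpace ℝ (Fin n))
    (lam : ι → ℝ) (f u : EuclideanSpace ℝ (Fin n) → ℝ) : ℝ :=
  -(∫ x in Poly l lam, Real.log ((hessianMatrix u x).det))
    + ((∫ z, u z ∂(sigmaW l lam)) - ∫ x in Poly l lam, f x * u x)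

/-- The gradient inequality for convex functions. -/
lemma add_fderiv_le_of_convexOn {E : Type*} [NormedAddCommGroup E] [NormedSpace ℝ E]
    {s : Set E} {f : E → ℝ} {f' : E →L[ℝ] ℝ} {x y : E} (hf : ConvexOn ℝ s f)
    (hx : x ∈ s) (hy : y ∈ s) (hf' : HasFDerivAt f f' x) : f x + f' (y - x) ≤ f y := by
  have hconv := hf.comp_affineMap (AffineMap.lineMap (k := ℝ) x y)
  have hd : HasDerivAt (f ∘ AffineMap.lineMap (k := ℝ) x y) (f' (y - x)) 0 := by
    refine HasFDerivAt.comp_hasDerivAt (0 : ℝ) ?_ AffineMap.hasDerivAt_lineMap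
    simpa using hf'
  have := hconv.le_slope_of_hasDerivAt (x := 0) (y := 1) (by simpa using hx) (by simpa using hy)
    one_pos hd
  simp [slope_def_field] at this
  rw [map_sub]
  linarith

/-- If the gradient of a convex function agrees at two points, it is constant on the segment
between them. -/
lemma fderiv_eq_of_mem_segment {E : Type*} [NormedAddCommGroup E] [NormedSpace ℝ E]
    {s : Set E} {f : E → ℝ} {x y z : E} (hs : IsOpen s) (hf : ConvexOn ℝ s f)
    (hd : DifferentiableOn ℝ f s) (hx : x ∈ s) (hy : y ∈ s) (hxy : fderiv ℝ f x = fderiv ℝ f y)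
    (hz : z ∈ segment ℝ x y) : fderiv ℝ f z = fderiv ℝ f x := by
  have hda : ∀ w ∈ s, HasFDerivAt f (fderiv ℝ f w) w := fun w hw =>
    (hd.differentiableAt (hs.mem_nhds hw)).hasFDerivAt
  have hzs : z ∈ s := hf.1.segment_subset hx hy hz
  have hmin : IsLocalMin (fun w => f w - fderiv ℝ f x w) z := by
    filter_upwards [hs.mem_nhds hzs] with w hw
    have h1 := add_fderiv_le_of_convexOn hf hx hw (hda x hx)
    have h2 := add_fderiv_le_of_convexOn hf hy hw (hda y hy)
    obtain ⟨a, b, ha, hb, hab, rfl⟩ := hz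
    have h3 := hf.2 hx hy ha hb hab
    rw [← hxy] at h2
    simp only [map_sub, map_add, map_smul, smul_eq_mul] at *
    obtain rfl : a = 1 - b := by linarith
    nlinarith
  have h0 := hmin.hasFDerivAt_eq_zero ((hda z hzs).sub (fderiv ℝ f x).hasFDerivAt)
  exact sub_eq_zero.mp h0

/-- A `C²` convex function has injective gradient on the set where its second derivative is
nondegenerate. -/
lemma injOn_fderiv_of_convexOn {E : Type*} [NormedAddCommGroup E] [NormedSpace ℝ E]
    {s t : Set E} {f : E → ℝ} (hs : IsOpen s) (hf : ConvexOn ℝ s f)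
    (hd : DifferentiableOn ℝ f s) (hd2 : DifferentiableOn ℝ (fderiv ℝ f) s) (ht : t ⊆ s)
    (hker : ∀ x ∈ t, ∀ v, fderiv ℝ (fderiv ℝ f) x v = 0 → v = 0) :
    InjOn (fderiv ℝ f) t := by
  intro x hx y hy hxy
  have h2 : HasDerivAt (fderiv ℝ f ∘ AffineMap.lineMap (k := ℝ) x y)
      (fderiv ℝ (fderiv ℝ f) x (y - x)) 0 := by
    refine HasFDerivAt.comp_hasDerivAt (0 : ℝ) ?_ AffineMap.hasDerivAt_lineMap
    simpa using (hd2.differentiableAt (hs.mem_nhds (ht hx))).hasFDerivAt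
  have h3 : HasDerivWithinAt (fderiv ℝ f ∘ AffineMap.lineMap (k := ℝ) x y) 0 (Icc 0 1) 0 := by
    refine (hasDerivWithinAt_const (0 : ℝ) (Icc 0 1) (fderiv ℝ f x)).congr ?_ (by simp)
    intro r hr
    refine fderiv_eq_of_mem_segment hs hf hd (ht hx) (ht hy) hxy ?_
    rw [segment_eq_image_lineMap]
    exact mem_image_of_mem _ hr
  have h4 := (uniqueDiffOn_Icc (zero_lt_one (α := ℝ)) 0 (by simp)).eq_deriv _
    h2.hasDerivWithinAt h3
  exact (sub_eq_zero.mp (hker x hx _ h4)).symm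

/-- Convergence of integrals along a sequence bounded in `L²` which converges a.e. -/
lemma tendsto_integral_of_ae_of_lintegral_sq_le {α : Type*} [MeasurableSpace α] {μ : Measure α}
    [IsFiniteMeasure μ] {f : ℕ → α → ℝ} {g : α → ℝ} {C : ℝ≥0∞} (hC : C ≠ ∞)
    (hf : ∀ m, AEStronglyMeasurable (f m) μ) (hbound : ∀ m, ∫⁻ x, ‖f m x‖ₑ ^ 2 ∂μ ≤ C)
    (hlim : ∀ᵐ x ∂μ, Tendsto (fun m => f m x) atTop (𝓝 (g x))) :
    Tendsto (fun m => ∫ x, f m x ∂μ) atTop (𝓝 (∫ x, g x ∂μ)) := by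
  have hg : AEStronglyMeasurable g μ := aestronglyMeasurable_of_tendsto_ae atTop hf hlim
  have memLp_one : ∀ {h : α → ℝ}, AEStronglyMeasurable h μ → ∫⁻ x, ‖h x‖ₑ ^ 2 ∂μ ≤ C →
      MemLp h 1 μ := by
    intro h hm hh
    refine MemLp.mono_exponent (q := 2) ⟨hm, ?_⟩ (by norm_num)
    rw [eLpNorm_lt_top_iff_lintegral_rpow_enorm_lt_top (by norm_num) (by norm_num)]
    simpa using hh.trans_lt hC.lt_top
  have hgC : ∫⁻ x, ‖g x‖ₑ ^ 2 ∂μ ≤ C := by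
    have h1 : ∀ᵐ x ∂μ, ‖g x‖ₑ ^ 2 = liminf (fun m => ‖f m x‖ₑ ^ 2) atTop := by
      filter_upwards [hlim] with x hx
      exact ((ENNReal.continuous_pow 2).tendsto _ |>.comp hx.enorm).liminf_eq.symm
    rw [lintegral_congr_ae h1]
    refine (lintegral_liminf_le' fun m => (hf m).enorm.pow_const 2).trans ?_
    exact liminf_le_of_le (by isBoundedDefault) fun b hb => by
      obtain ⟨m, hm⟩ := hb.exists
      exact hm.trans (hbound m)
  refine tendsto_integral_of_L1' g hg
    (Eventually.of_forall fun m => memLp_one_iff_integrable.1 (memLp_one (hf m) (hbound m))) ?_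
  refine tendsto_Lp_finite_of_tendsto_ae le_rfl (by norm_num) hf (memLp_one hg hgC) ?_ hlim
  refine unifIntegrable_of le_rfl (by norm_num) hf fun ε hε => ?_
  have hε' : ENNReal.ofReal ε ≠ 0 := by simpa using hε
  refine ⟨(C / ENNReal.ofReal ε).toNNReal + 1, fun m => ?_⟩
  set K : ℝ≥0 := (C / ENNReal.ofReal ε).toNNReal + 1 with hK
  have hCK : C ≤ ENNReal.ofReal ε * K := by
    have h1 : C / ENNReal.ofReal ε ≤ K := by
      rw [hK, ENNReal.coe_add, ENNReal.coe_toNNReal (ENNReal.div_ne_top hC hε')]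
      exact le_self_add
    rw [mul_comm]
    exact (ENNReal.div_le_iff hε' ENNReal.ofReal_ne_top).1 h1
  have hK0 : (K : ℝ≥0∞) ≠ 0 := by simp [hK]
  rw [eLpNorm_one_eq_lintegral_enorm]
  refine (ENNReal.mul_le_mul_iff_left hK0 ENNReal.coe_ne_top).1 (le_trans ?_ hCK)
  rw [← lintegral_mul_const' _ _ ENNReal.coe_ne_top]
  refine le_trans (lintegral_mono fun x => ?_) (hbound m)
  by_cases hx : x ∈ {x | K ≤ ‖f m x‖₊}
  · rw [indicator_of_mem hx, sq]
    gcongr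
    exact ENNReal.coe_le_coe.2 hx
  · simp [indicator_of_notMem hx]

/-- The coordinates of a linear form on `ℝⁿ` in the standard dual basis. -/
def dualCoord (n : ℕ) :
    (EuclideanSpace ℝ (Fin n) →L[ℝ] ℝ) →L[ℝ] EuclideanSpace ℝ (Fin n) :=
  (EuclideanSpace.equiv (Fin n) ℝ).symm.toContinuousLinearMap ∘L
    ContinuousLinearMap.pi fun i =>
      ContinuousLinearMap.apply ℝ ℝ (EuclideanSpace.single i (1 : ℝ))

lemma dualCoord_apply {n : ℕ} (φ : EuclideanSpace ℝ (Fin n) →L[ℝ] ℝ) (i : Fin n) :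
    dualCoord n φ i = φ (EuclideanSpace.single i 1) := rfl

lemma dualCoord_injective (n : ℕ) : Function.Injective (dualCoord n) := by
  intro φ ψ h
  ext x
  have hx := (EuclideanSpace.basisFun (Fin n) ℝ).sum_repr x
  rw [← hx, map_sum, map_sum]
  refine Finset.sum_congr rfl fun i _ => ?_
  have := congrArg (fun v : EuclideanSpace ℝ (Fin n) => v i) h
  simp only [dualCoord_apply] at this
  simp [this]

lemma det_dualCoord_comp {n : ℕ} (u : EuclideanSpace ℝ (Fin n) → ℝ)
    (x : EuclideanSpace ℝ (Fin n)) :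
    (dualCoord n ∘L fderiv ℝ (fderiv ℝ u) x).det = (hessianMatrix u x).det := by
  rw [ContinuousLinearMap.det,
    ← LinearMap.det_toMatrix (EuclideanSpace.basisFun (Fin n) ℝ).toBasis,
    ← Matrix.det_transpose (hessianMatrix u x)]
  congr 1
  ext i j
  simp [LinearMap.toMatrix_apply, hessianMatrix, secondPartial, iteratedFDeriv_two_apply,
    dualCoord_apply]

lemma continuousOn_det_hessianMatrix {n : ℕ} {s : Set (EuclideanSpace ℝ (Fin n))}
    {u : EuclideanSpace ℝ (Fin n) → ℝ} (hs : IsOpen s) (hu : ContDiffOn ℝ 2 u s) :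
    ContinuousOn (fun x => (hessianMatrix u x).det) s := by
  have h1 : ContDiffOn ℝ 1 (fderiv ℝ u) s := hu.fderiv_of_isOpen hs (by norm_num)
  have h2 : ContinuousOn (fderiv ℝ (fderiv ℝ u)) s :=
    h1.continuousOn_fderiv_of_isOpen hs le_rfl
  simp_rw [← det_dualCoord_comp]
  exact ContinuousLinearMap.continuous_det.comp_continuousOn
    (continuousOn_const.clm_comp h2)

/-- The Monge–Ampère mass of a `C²` convex function is bounded in terms of its gradient. -/
lemma lintegral_det_hessianMatrix_le {n : ℕ} {s t : Set (EuclideanSpace ℝ (Fin n))}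
    {u : EuclideanSpace ℝ (Fin n) → ℝ} {L : ℝ} (hs : IsOpen s) (hu : ConvexOn ℝ s u)
    (hu2 : ContDiffOn ℝ 2 u s) (ht : t ⊆ s) (htm : MeasurableSet t)
    (hdet : ∀ x ∈ t, (hessianMatrix u x).det ≠ 0) (hL : ∀ x ∈ t, ‖fderiv ℝ u x‖ ≤ L) :
    ∫⁻ x in t, ENNReal.ofReal |(hessianMatrix u x).det|
      ≤ volume (closedBall (0 : EuclideanSpace ℝ (Fin n)) (‖dualCoord n‖ * L)) := by
  have h1 : ContDiffOn ℝ 1 (fderiv ℝ u) s := hu2.fderiv_of_isOpen hs (by norm_num)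
  have hd2 : DifferentiableOn ℝ (fderiv ℝ u) s := h1.differentiableOn (by norm_num)
  have hinj : InjOn (dualCoord n ∘ fderiv ℝ u) t := by
    refine (dualCoord_injective n).comp_injOn
      (injOn_fderiv_of_convexOn hs hu (hu2.differentiableOn (by norm_num)) hd2 ht ?_)
    intro x hx v hv
    have hne := hdet x hx
    rw [← det_dualCoord_comp] at hne
    by_contra hv0
    exact hne (LinearMap.det_eq_zero_iff_ker_ne_bot.2 <|
      (Submodule.ne_bot_iff _).2 ⟨v, by simp [hv], hv0⟩)
  have hderiv : ∀ x ∈ t, HasFDerivWithinAt (dualCoord n ∘ fderiv ℝ u)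
      (dualCoord n ∘L fderiv ℝ (fderiv ℝ u) x) t x := fun x hx =>
    ((dualCoord n).hasFDerivAt.comp x
      (hd2.differentiableAt (hs.mem_nhds (ht hx))).hasFDerivAt).hasFDerivWithinAt
  have harea := lintegral_abs_det_fderiv_eq_addHaar_image volume htm hderiv hinj
  simp_rw [det_dualCoord_comp] at harea
  rw [harea]
  refine measure_mono ?_
  rintro _ ⟨x, hx, rfl⟩
  rw [mem_closedBall_zero_iff]
  exact ((dualCoord n).le_opNorm _).trans (by gcongr; exact hL x hx)

/-- The gradient of a convex function at the centre of a ball is bounded by its sup norm there. -/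
lemma norm_fderiv_le_of_convexOn {E : Type*} [NormedAddCommGroup E] [NormedSpace ℝ E]
    {s : Set E} {f : E → ℝ} {x : E} {δ M : ℝ} (hf : ConvexOn ℝ s f) (hδ : 0 < δ)
    (hs : ball x δ ⊆ s) (hM : ∀ y ∈ ball x δ, |f y| ≤ M) :
    ‖fderiv ℝ f x‖ ≤ 4 * M / δ := by
  have hM0 : 0 ≤ M := (abs_nonneg _).trans (hM x (mem_ball_self hδ))
  have h := (hf.subset hs (convex_ball x δ)).lipschitzOnWith_of_abs_le (half_pos hδ) hM
  have := norm_fderiv_le_of_lipschitzOn ℝ (ball_mem_nhds x (by linarith)) h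
  rw [Real.coe_toNNReal _ (by positivity)] at this
  exact this.trans_eq (by field_simp; ring)

/-- A locally uniformly convergent sequence of convex functions has eventually uniformly bounded
gradients on compact sets. -/
lemma eventually_norm_fderiv_le {E : Type*} [NormedAddCommGroup E] [NormedSpace ℝ E]
    [FiniteDimensional ℝ E] {s K : Set E} {f : ℕ → E → ℝ} {g : E → ℝ} (hs : IsOpen s)
    (hf : ∀ m, ConvexOn ℝ s (f m)) (hg : ConvexOn ℝ s g)
    (hfg : TendstoLocallyUniformlyOn f g atTop s) (hK : IsCompact K) (hKs : K ⊆ s) :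
    ∃ L, ∀ᶠ m in atTop, ∀ x ∈ K, ‖fderiv ℝ (f m) x‖ ≤ L := by
  have : ProperSpace E := FiniteDimensional.proper_real E
  obtain ⟨δ, hδ, hδs⟩ := hK.exists_cthickening_subset_open hs hKs
  have hKδ : IsCompact (cthickening δ K) := hK.cthickening
  obtain ⟨M, hM⟩ := hKδ.exists_bound_of_continuousOn ((hg.continuousOn hs).mono hδs)
  have hunif := (tendstoLocallyUniformlyOn_iff_forall_isCompact hs).1 hfg _ hδs hKδ
  refine ⟨4 * (M + 1) / δ, ?_⟩
  filter_upwards [Metric.tendstoUniformlyOn_iff.1 hunif 1 one_pos] with m hm x hx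
  have hball : ball x δ ⊆ cthickening δ K :=
    ball_subset_closedBall.trans (closedBall_subset_cthickening hx δ)
  refine norm_fderiv_le_of_convexOn (hf m) hδ (hball.trans hδs) fun y hy => ?_
  have h1 := hm y (hball hy)
  have h2 := hM y (hball hy)
  rw [Real.norm_eq_abs, abs_le] at h2
  rw [Real.dist_eq, abs_lt] at h1
  rw [abs_le]
  constructor <;> linarith [h1.1, h1.2, h2.1, h2.2]

lemma sq_log_le {ε t : ℝ} (hε : 0 < ε) (ht : ε ≤ t) :
    Real.log t ^ 2 ≤ Real.log ε ^ 2 + 4 * t := by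
  have ht0 : 0 < t := hε.trans_le ht
  have hlog := Real.log_le_log hε ht
  rcases le_total 0 (Real.log t) with h | h
  · have h1 : Real.log t ≤ 2 * √t := by
      have h2 := Real.log_le_sub_one_of_pos (Real.sqrt_pos.2 ht0)
      rw [Real.log_sqrt ht0.le] at h2
      linarith
    have h3 := pow_le_pow_left₀ h h1 2
    rw [mul_pow, Real.sq_sqrt ht0.le] at h3
    nlinarith [sq_nonneg (Real.log ε)]
  · nlinarith

lemma le_of_ae_le_of_continuousOn {n : ℕ} {s : Set (EuclideanSpace ℝ (Fin n))}
    {f : EuclideanSpace ℝ (Fin n) → ℝ} {c : ℝ} (hs : IsOpen s) (hf : ContinuousOn f s)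
    (h : ∀ᵐ x ∂(volume.restrict s), c ≤ f x) : ∀ x ∈ s, c ≤ f x := by
  have ho : IsOpen (s ∩ f ⁻¹' Iio c) := hf.isOpen_inter_preimage hs isOpen_Iio
  have h0 : volume (s ∩ f ⁻¹' Iio c) = 0 := by
    rw [ae_restrict_iff' hs.measurableSet] at h
    refine measure_mono_null ?_ h
    rintro x ⟨hx, hx'⟩ hcon
    exact absurd (hcon hx) (not_le.2 hx')
  rw [ho.measure_eq_zero_iff volume] at h0
  intro x hx
  by_contra hlt
  exact (h0 ▸ (⟨hx, not_le.1 hlt⟩ : x ∈ s ∩ f ⁻¹' Iio c) : x ∈ (∅ : Set _))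

lemma isOpen_poly {n : ℕ} {ι : Type*} [Fintype ι] (l : ι → EuclideanSpace ℝ (Fin n))
    (lam : ι → ℝ) : IsOpen (Poly l lam) := by
  simp only [Poly, ofPred_forall]
  exact isOpen_iInter_of_finite fun i => isOpen_lt (by fun_prop) continuous_const

/-- Lemma 2.2: stability of `∫ log det` on compact subsets under a.e.
convergence of the determinants, given a uniform positive lower bound `ε₀`. -/
theorem logdet_tendsto_on_compacts
    (n d : ℕ) (hn : 1 ≤ n) (l : Fin d → EuclideanSpace ℝ (Fin n)) (lam : Fin d → ℝ)
    (hl : ∀ i, l i ≠ 0) (hbd : Bornology.IsBounded (Poly l lam))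
    (u : EuclideanSpace ℝ (Fin n) → ℝ)
    (H : EuclideanSpace ℝ (Fin n) → Matrix (Fin n) (Fin n) ℝ)
    (hu : ConvexOn ℝ (Poly l lam) u) (hH : IsAlexHessian (Poly l lam) u H)
    (useq : ℕ → EuclideanSpace ℝ (Fin n) → ℝ)
    (hconvex : ∀ m, ConvexOn ℝ (Poly l lam) (useq m))
    (hC2 : ∀ m, ContDiffOn ℝ 2 (useq m) (Poly l lam))
    (hconv : TendstoLocallyUniformlyOn useq u atTop (Poly l lam))
    (hdet : ∀ᵐ x ∂(volume.restrict (Poly l lam)),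
      Tendsto (fun m => (hessianMatrix (useq m) x).det) atTop (𝓝 ((H x).det)))
    (ε₀ : ℝ) (hε₀ : 0 < ε₀)
    (hlbn : ∀ m, ∀ᵐ x ∂(volume.restrict (Poly l lam)), ε₀ ≤ (hessianMatrix (useq m) x).det)
    (hlb : ∀ᵐ x ∂(volume.restrict (Poly l lam)), ε₀ ≤ (H x).det) :
    ∀ Ω : Set (EuclideanSpace ℝ (Fin n)), IsOpen Ω → IsCompact (closure Ω) →
      closure Ω ⊆ Poly l lam →
      Tendsto (fun m => ∫ x in Ω, Real.log ((hessianMatrix (useq m) x).det)) atTop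
        (𝓝 (∫ x in Ω, Real.log ((H x).det))) := by
  intro Ω hΩ hΩc hΩP
  have hP := isOpen_poly l lam
  have hsub : Ω ⊆ Poly l lam := subset_closure.trans hΩP
  have hcont := fun m => continuousOn_det_hessianMatrix hP (hC2 m)
  have hlow := fun m => le_of_ae_le_of_continuousOn hP (hcont m) (hlbn m)
  have hvol : volume Ω < ∞ := (measure_mono subset_closure).trans_lt hΩc.measure_lt_top
  have : IsFiniteMeasure (volume.restrict Ω) := ⟨by simpa using hvol⟩
  obtain ⟨L, hL⟩ := eventually_norm_fderiv_le hP hconvex hu hconv hΩc hΩP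
  obtain ⟨N, hN⟩ := eventually_atTop.1 hL
  rw [← tendsto_add_atTop_iff_nat N]
  set V := volume (closedBall (0 : EuclideanSpace ℝ (Fin n)) (‖dualCoord n‖ * L)) with hV
  have hVtop : V ≠ ∞ := measure_closedBall_lt_top.ne
  refine tendsto_integral_of_ae_of_lintegral_sq_le
    (C := ENNReal.ofReal (Real.log ε₀ ^ 2) * volume Ω + 4 * V) ?_ ?_ ?_ ?_
  · finiteness
  · intro m
    refine ContinuousOn.aestronglyMeasurable ?_ hΩ.measurableSet
    exact ((hcont _).mono hsub).log fun x hx => (hε₀.trans_le (hlow _ x (hsub hx))).ne'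
  · intro m
    have hmass : ∫⁻ x in Ω, ENNReal.ofReal |(hessianMatrix (useq (m + N)) x).det| ≤ V :=
      lintegral_det_hessianMatrix_le hP (hconvex _) (hC2 _) hsub hΩ.measurableSet
        (fun x hx => (hε₀.trans_le (hlow _ x (hsub hx))).ne')
        fun x hx => hN _ (Nat.le_add_left _ _) x (subset_closure hx)
    calc ∫⁻ x in Ω, ‖Real.log (hessianMatrix (useq (m + N)) x).det‖ₑ ^ 2
        ≤ ∫⁻ x in Ω, (ENNReal.ofReal (Real.log ε₀ ^ 2)
            + 4 * ENNReal.ofReal |(hessianMatrix (useq (m + N)) x).det|) := by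
          refine setLIntegral_mono' hΩ.measurableSet fun x hx => ?_
          have hx' := hlow (m + N) x (hsub hx)
          rw [Real.enorm_eq_ofReal_abs, ← ENNReal.ofReal_pow (abs_nonneg _), sq_abs,
            abs_of_pos (hε₀.trans_le hx'),
            show (4 : ℝ≥0∞) = ENNReal.ofReal 4 by norm_num,
            ← ENNReal.ofReal_mul (by norm_num),
            ← ENNReal.ofReal_add (sq_nonneg _) (by linarith)]
          exact ENNReal.ofReal_le_ofReal (sq_log_le hε₀ hx')
      _ ≤ ENNReal.ofReal (Real.log ε₀ ^ 2) * volume Ω + 4 * V := by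
          rw [lintegral_add_left measurable_const, lintegral_const_mul' _ _ (by norm_num)]
          simp only [lintegral_const, Measure.restrict_apply_univ]
          gcongr
  · filter_upwards [ae_restrict_of_ae_restrict_of_subset hsub hdet,
      ae_restrict_of_ae_restrict_of_subset hsub hlb] with x hx hx'
    exact ((Real.continuousAt_log (hε₀.trans_le hx').ne').tendsto.comp hx).comp
      (tendsto_add_atTop_nat N)

end ToricExtremal
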